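/- arXiv:2301.00644 — 7 statements merged into one kernel-verified Lean document; each statement's English description precedes it below -/
import Mathlib

section
/- For every natural number n ≥ 2, the integer ⌊√2·n⌋ is even if and only if the fractional part {n/√2} satisfies {n/√2} ≤ 1/2. -/
theorem stmt_1 (n : ℕ) (hn : 2 ≤ n) :
    Even ⌊Real.sqrt 2 * n⌋ ↔ Int.fract ((n : ℝ) / Real.sqrt 2) ≤ 1 / 2 := by
  have hs : Real.sqrt 2 * Real.sqrt 2 = 2 := Real.mul_self_sqrt (by norm_num)
  have hs0 : 0 < Real.sqrt 2 := Real.sqrt_pos.mpr (by norm_num)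
  have hx : Real.sqrt 2 * n = 2 * ((n : ℝ) / Real.sqrt 2) := by
    field_simp
    nlinarith
  have hirr : Irrational (Real.sqrt 2 * n) :=
    irrational_sqrt_two.mul_natCast (by omega)
  have h1 := Int.floor_add_fract ((n : ℝ) / Real.sqrt 2)
  have h2 := Int.fract_nonneg ((n : ℝ) / Real.sqrt 2)
  have h3 := Int.fract_lt_one ((n : ℝ) / Real.sqrt 2)
  generalize Int.fract ((n : ℝ) / Real.sqrt 2) = f at *
  generalize ⌊(n : ℝ) / Real.sqrt 2⌋ = m at *
  rcases lt_trichotomy f (1 / 2) with h | h | h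
  · have : ⌊Real.sqrt 2 * n⌋ = 2 * m := by
      rw [Int.floor_eq_iff]
      push_cast
      constructor <;> linarith
    rw [this]
    exact ⟨fun _ => h.le, fun _ => even_two_mul m⟩
  · exfalso
    apply hirr.ne_int (2 * m + 1)
    push_cast
    linarith
  · have : ⌊Real.sqrt 2 * n⌋ = 2 * m + 1 := by
      rw [Int.floor_eq_iff]
      push_cast
      constructor <;> linarith
    rw [this]
    refine ⟨fun he => ?_, fun hf => absurd hf (not_le.mpr h)⟩
    obtain ⟨k, hk⟩ := he
    omega
end

section
/- For every natural number n ≥ 2, the integer ⌊√2·n⌋ is even if and only if ⌊√2·n·⌊n/√2⌋⌋ = ⌊(n/√2)·⌊√2·n⌋⌋. -/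
theorem stmt_3 (n : ℕ) (hn : 2 ≤ n) :
    Even ⌊Real.sqrt 2 * n⌋ ↔
      ⌊Real.sqrt 2 * n * (⌊(n : ℝ) / Real.sqrt 2⌋ : ℝ)⌋ =
        ⌊(n : ℝ) / Real.sqrt 2 * (⌊Real.sqrt 2 * n⌋ : ℝ)⌋ := by
  have hs : Real.sqrt 2 * Real.sqrt 2 = 2 := Real.mul_self_sqrt (by norm_num)
  have hpos : 0 < Real.sqrt 2 := by positivity
  have h1 : 1 < Real.sqrt 2 := by nlinarith
  have hn' : (2 : ℝ) ≤ n := by exact_mod_cast hn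
  have hdiv : (n : ℝ) / Real.sqrt 2 = Real.sqrt 2 * n / 2 := by
    rw [div_eq_div_iff hpos.ne' (by norm_num)]
    linear_combination (-(n : ℝ)) * hs
  rw [hdiv]
  have hx : 2 < Real.sqrt 2 * n := by nlinarith
  generalize Real.sqrt 2 * (n : ℝ) = x at hx
  have hl := Int.floor_le x
  have hu := Int.lt_floor_add_one x
  generalize ⌊x⌋ = m at hl hu
  rcases Int.even_or_odd' m with ⟨k, rfl | rfl⟩
  · have hk : ⌊x / 2⌋ = k := by
      rw [Int.floor_eq_iff]
      push_cast at hl hu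
      constructor <;> linarith
    rw [hk]
    refine iff_of_true (even_two_mul k) ?_
    congr 1
    push_cast
    ring
  · have hk : ⌊x / 2⌋ = k := by
      rw [Int.floor_eq_iff]
      push_cast at hl hu
      constructor <;> linarith
    rw [hk]
    refine iff_of_false (by simp) (ne_of_lt ?_)
    rw [Int.lt_iff_add_one_le, Int.le_floor]
    have := Int.floor_le (x * (k : ℝ))
    push_cast
    nlinarith
end

section
/- For every natural number n ≥ 2, the integer ⌊√2·n⌋ is even if and only if ⌊n/√2⌋ = ⌊√(n² − ⌊n/√2⌋²)⌋. -/
theorem stmt_4 (n : ℕ) (hn : 2 ≤ n) :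
    Even ⌊Real.sqrt 2 * n⌋ ↔
      ⌊(n : ℝ) / Real.sqrt 2⌋ =
        ⌊Real.sqrt ((n : ℝ) ^ 2 - (⌊(n : ℝ) / Real.sqrt 2⌋ : ℝ) ^ 2)⌋ := by
  have hs : Real.sqrt 2 ^ 2 = 2 := Real.sq_sqrt (by norm_num)
  have hs0 : 0 < Real.sqrt 2 := by positivity
  obtain ⟨x, hx⟩ : ∃ x : ℝ, x = (n : ℝ) / Real.sqrt 2 := ⟨_, rfl⟩
  have hx0 : 0 ≤ x := by rw [hx]; positivity
  have hnx : (n : ℝ) = x * Real.sqrt 2 := by rw [hx]; field_simp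
  have hx2 : (n : ℝ) ^ 2 = 2 * x ^ 2 := by rw [hnx, mul_pow, hs]; ring
  have h2x : Real.sqrt 2 * n = 2 * x := by rw [hnx]; nlinarith
  rw [h2x, ← hx]
  obtain ⟨m, hm⟩ : ∃ m : ℤ, m = ⌊x⌋ := ⟨_, rfl⟩
  rw [← hm]
  have hm0 : 0 ≤ m := by rw [hm]; exact Int.floor_nonneg.mpr hx0
  have hm0' : (0 : ℝ) ≤ m := by exact_mod_cast hm0
  have h1 : (m : ℝ) ≤ x := by rw [hm]; exact Int.floor_le x
  have h2 : x < m + 1 := by rw [hm]; exact Int.lt_floor_add_one x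
  have key : x < m + 1 / 2 ↔ (n : ℝ) ^ 2 < 2 * m ^ 2 + 2 * m + 1 := by
    constructor
    · intro h
      rw [hx2]; nlinarith
    · intro h
      have hi : (n : ℤ) ^ 2 < 2 * m ^ 2 + 2 * m + 1 := by exact_mod_cast h
      have hi' : (n : ℤ) ^ 2 ≤ 2 * m ^ 2 + 2 * m := by omega
      have h' : (n : ℝ) ^ 2 ≤ 2 * m ^ 2 + 2 * m := by exact_mod_cast hi'
      rw [hx2] at h'
      by_contra! hc
      nlinarith
  have hL : Even ⌊2 * x⌋ ↔ x < m + 1 / 2 := by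
    constructor
    · rintro ⟨r, hr⟩
      rw [Int.floor_eq_iff] at hr
      push_cast at hr
      have : r = m := by
        have a : r < m + 1 := by
          have : (r : ℝ) < m + 1 := by linarith
          exact_mod_cast this
        have b : m < r + 1 := by
          have : (m : ℝ) < r + 1 := by linarith
          exact_mod_cast this
        omega
      subst this
      linarith
    · intro h
      refine ⟨m, ?_⟩
      rw [Int.floor_eq_iff]
      push_cast
      constructor <;> linarith
  rw [hL, key, eq_comm, Int.floor_eq_iff]
  have hle : (m : ℝ) ≤ Real.sqrt ((n : ℝ) ^ 2 - (m : ℝ) ^ 2) := by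
    apply Real.le_sqrt_of_sq_le
    rw [hx2]; nlinarith
  rw [Real.sqrt_lt' (by linarith)]
  constructor
  · intro h
    exact ⟨hle, by nlinarith⟩
  · rintro ⟨_, h⟩
    nlinarith
end

section
/- For every natural number n ≥ 2, the integer ⌊√2·n⌋ is even if and only if the fractional part {n/√2} satisfies {n/√2} < √(⌊n/√2⌋² + ⌊n/√2⌋ + 1/2) − ⌊n/√2⌋. -/
theorem stmt_5 (n : ℕ) (hn : 2 ≤ n) :
    Even ⌊Real.sqrt 2 * n⌋ ↔
      Int.fract ((n : ℝ) / Real.sqrt 2) <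
        Real.sqrt ((⌊(n : ℝ) / Real.sqrt 2⌋ : ℝ) ^ 2 + (⌊(n : ℝ) / Real.sqrt 2⌋ : ℝ) + 1 / 2)
          - (⌊(n : ℝ) / Real.sqrt 2⌋ : ℝ) := by
  have hs : Real.sqrt 2 * Real.sqrt 2 = 2 := Real.mul_self_sqrt (by norm_num)
  have hpos : 0 < Real.sqrt 2 := by positivity
  have h2x : Real.sqrt 2 * n = 2 * ((n : ℝ) / Real.sqrt 2) := by
    field_simp
    nlinarith
  have hxx : 2 * ((n : ℝ) / Real.sqrt 2) ^ 2 = (n : ℝ) ^ 2 := by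
    rw [div_pow, sq (Real.sqrt 2), hs]; ring
  have hx0 : 0 ≤ (n : ℝ) / Real.sqrt 2 := by positivity
  rw [h2x, Int.fract]
  generalize (n : ℝ) / Real.sqrt 2 = x at *
  have hm0 : 0 ≤ ⌊x⌋ := Int.floor_nonneg.mpr hx0
  have h1 := Int.floor_le x
  have h2 := Int.lt_floor_add_one x
  generalize ⌊x⌋ = m at *
  have hm0' : (0 : ℝ) ≤ m := by exact_mod_cast hm0
  rw [sub_lt_sub_iff_right, Real.lt_sqrt hx0]
  have key : x ^ 2 < (m : ℝ) ^ 2 + m + 1 / 2 ↔ x < m + 1 / 2 := by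
    constructor
    · intro h
      have h3 : (n : ℝ) ^ 2 < 2 * m ^ 2 + 2 * m + 1 := by linarith
      have h4 : (n : ℤ) ^ 2 < 2 * m ^ 2 + 2 * m + 1 := by exact_mod_cast h3
      have h5 : (n : ℤ) ^ 2 ≤ 2 * m ^ 2 + 2 * m := by omega
      have h6 : (n : ℝ) ^ 2 ≤ 2 * m ^ 2 + 2 * m := by exact_mod_cast h5
      by_contra hc
      nlinarith
    · intro h
      nlinarith
  rw [key]
  constructor
  · rintro ⟨k, hk⟩
    by_contra hc
    have : ⌊2 * x⌋ = 2 * m + 1 := by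
      rw [Int.floor_eq_iff]; push_cast; constructor <;> linarith
    omega
  · intro h
    have : ⌊2 * x⌋ = 2 * m := by
      rw [Int.floor_eq_iff]; push_cast; constructor <;> linarith
    rw [this]; exact even_two_mul m
end

section
/- For every natural number n ≥ 2, the fractional parts condition {n/√2} ≤ 1/2 holds if and only if ⌊√2·n·⌊n/√2⌋⌋ = ⌊(n/√2)·⌊√2·n⌋⌋. (In particular, OEIS sequences A120752 and A090892 are essentially identical.) -/
theorem stmt_6 (n : ℕ) (hn : 2 ≤ n) :
    Int.fract ((n : ℝ) / Real.sqrt 2) ≤ 1 / 2 ↔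
      ⌊Real.sqrt 2 * n * (⌊(n : ℝ) / Real.sqrt 2⌋ : ℝ)⌋ =
        ⌊(n : ℝ) / Real.sqrt 2 * (⌊Real.sqrt 2 * n⌋ : ℝ)⌋ := by
  have hs : Real.sqrt 2 * Real.sqrt 2 = 2 := Real.mul_self_sqrt (by norm_num)
  have hs0 : 0 < Real.sqrt 2 := by positivity
  have hn' : (2 : ℝ) ≤ n := by exact_mod_cast hn
  obtain ⟨x, hx⟩ : ∃ x : ℝ, x = (n : ℝ) / Real.sqrt 2 := ⟨_, rfl⟩
  have hxs : x * Real.sqrt 2 = n := by rw [hx]; field_simp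
  have h2 : Real.sqrt 2 * n = 2 * x := by rw [← hxs]; linear_combination x * hs
  have hsq : 2 * (x * x) = (n : ℝ) * n := by rw [← hxs]; linear_combination (-x * x) * hs
  have hx0 : 0 ≤ x := by rw [hx]; positivity
  have hx1 : 1 ≤ x := by nlinarith
  rw [h2, ← hx]
  obtain ⟨a, ha⟩ : ∃ a : ℤ, a = ⌊x⌋ := ⟨_, rfl⟩
  have hfl : (a : ℝ) ≤ x := by rw [ha]; exact Int.floor_le x
  have hfu : x < a + 1 := by rw [ha]; exact Int.lt_floor_add_one x
  rw [Int.fract, ← ha]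
  constructor
  · intro h
    have hne : x ≠ a + 1 / 2 := by
      intro he
      rw [he] at hsq
      have h3 : ((2 * a + 1) * (2 * a + 1) : ℝ) = 2 * ((n : ℝ) * n) := by linarith
      have h4 : (2 * a + 1) * (2 * a + 1) = 2 * ((n : ℤ) * n) := by exact_mod_cast h3
      have h5 : 2 * (2 * (a * a) + 2 * a) + 1 = 2 * ((n : ℤ) * n) := by linarith
      omega
    have hlt : x < a + 1 / 2 := lt_of_le_of_ne (by linarith) hne
    have hb : ⌊2 * x⌋ = 2 * a := by
      rw [Int.floor_eq_iff]; push_cast; constructor <;> linarith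
    rw [hb]; push_cast; congr 1; ring
  · intro h
    by_contra hc
    have hb : ⌊2 * x⌋ = 2 * a + 1 := by
      rw [Int.floor_eq_iff]; push_cast; constructor <;> linarith
    rw [hb] at h
    have h6 : ⌊2 * x * a⌋ + 1 ≤ ⌊x * ((2 * a + 1 : ℤ) : ℝ)⌋ := by
      rw [Int.le_floor]
      push_cast
      have := Int.floor_le (2 * x * a)
      linarith
    omega
end

section
/- For every natural number n ≥ 2, one has ⌊√2·n·⌊n/√2⌋⌋ = ⌊(n/√2)·⌊√2·n⌋⌋ if and only if ⌊√2·n⌋ = 2·⌊n/√2⌋. -/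
theorem stmt_10 (n : ℕ) (hn : 2 ≤ n) :
    ⌊Real.sqrt 2 * n * (⌊(n : ℝ) / Real.sqrt 2⌋ : ℝ)⌋ =
        ⌊(n : ℝ) / Real.sqrt 2 * (⌊Real.sqrt 2 * n⌋ : ℝ)⌋ ↔
      ⌊Real.sqrt 2 * n⌋ = 2 * ⌊(n : ℝ) / Real.sqrt 2⌋ := by
  have hs : Real.sqrt 2 * Real.sqrt 2 = 2 := Real.mul_self_sqrt (by norm_num)
  have hs0 : 0 < Real.sqrt 2 := by positivity
  have hn' : (2 : ℝ) ≤ n := by exact_mod_cast hn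
  have hx1 : 1 ≤ (n : ℝ) / Real.sqrt 2 := by
    rw [le_div_iff₀ hs0]
    nlinarith
  have h2 : Real.sqrt 2 * n = 2 * ((n : ℝ) / Real.sqrt 2) := by
    field_simp
    nlinarith
  rw [h2]
  generalize (n : ℝ) / Real.sqrt 2 = x at *
  have a1 := Int.floor_le x
  have a2 := Int.lt_floor_add_one x
  have b : ⌊2 * x⌋ = 2 * ⌊x⌋ ∨ ⌊2 * x⌋ = 2 * ⌊x⌋ + 1 := by
    have h1 : 2 * ⌊x⌋ ≤ ⌊2 * x⌋ := by
      rw [Int.le_floor]; push_cast; linarith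
    have h3 : ⌊2 * x⌋ < 2 * ⌊x⌋ + 2 := by
      rw [Int.floor_lt]; push_cast; linarith
    omega
  rcases b with b | b
  · rw [b]
    simp only [iff_true]
    congr 1
    push_cast
    ring
  · rw [b]
    constructor
    · intro h
      exfalso
      have h4 : ⌊2 * x * (⌊x⌋ : ℝ)⌋ + 1 ≤ ⌊x * ((2 * ⌊x⌋ + 1 : ℤ) : ℝ)⌋ := by
        rw [Int.le_floor]
        have := Int.floor_le (2 * x * (⌊x⌋ : ℝ))
        push_cast
        linarith
      omega
    · intro h
      omega
end

section
/- There exists no natural number n ≥ 2 such that 1/2 ≤ {n/√2} < √(⌊n/√2⌋² + ⌊n/√2⌋ + 1/2) − ⌊n/√2⌋. -/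
theorem stmt_13 :
    ¬ ∃ n : ℕ, 2 ≤ n ∧
      1 / 2 ≤ Int.fract ((n : ℝ) / Real.sqrt 2) ∧
      Int.fract ((n : ℝ) / Real.sqrt 2) <
        Real.sqrt ((⌊(n : ℝ) / Real.sqrt 2⌋ : ℝ) ^ 2 + (⌊(n : ℝ) / Real.sqrt 2⌋ : ℝ) + 1 / 2)
          - (⌊(n : ℝ) / Real.sqrt 2⌋ : ℝ) := by
  rintro ⟨n, -, h1, h2⟩
  have hx0 : 0 ≤ (n : ℝ) / Real.sqrt 2 := by positivity
  have hsq : ((n : ℝ) / Real.sqrt 2) ^ 2 = (n : ℝ) ^ 2 / 2 := by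
    rw [div_pow, Real.sq_sqrt (by norm_num)]
  have hf := Int.floor_add_fract ((n : ℝ) / Real.sqrt 2)
  have hm0 : 0 ≤ ⌊(n : ℝ) / Real.sqrt 2⌋ := Int.floor_nonneg.mpr hx0
  generalize Int.fract ((n : ℝ) / Real.sqrt 2) = f at *
  generalize ⌊(n : ℝ) / Real.sqrt 2⌋ = m at *
  generalize (n : ℝ) / Real.sqrt 2 = x at *
  have hm : (0 : ℝ) ≤ m := by exact_mod_cast hm0
  have h3 : x < Real.sqrt ((m : ℝ) ^ 2 + m + 1 / 2) := by linarith
  have h4 := (Real.lt_sqrt hx0).mp h3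
  have h5 : (m : ℝ) + 1 / 2 ≤ x := by linarith
  have h6 : ((m : ℝ) + 1 / 2) ^ 2 ≤ x ^ 2 := by gcongr
  have h7 : ((n : ℤ) : ℝ) ^ 2 < 2 * (m : ℝ) ^ 2 + 2 * m + 1 := by push_cast; linarith
  have h8 : 2 * (m : ℝ) ^ 2 + 2 * m < ((n : ℤ) : ℝ) ^ 2 := by push_cast; nlinarith
  have h9 : (n : ℤ) ^ 2 < 2 * m ^ 2 + 2 * m + 1 := by exact_mod_cast h7
  have h10 : 2 * m ^ 2 + 2 * m < (n : ℤ) ^ 2 := by exact_mod_cast h8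
  linarith [Int.add_one_le_iff.mpr h10]
end
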